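/- arXiv:1410.8406 — 2 statements merged into one kernel-verified Lean document; each statement's English description precedes it below -/
import Mathlib

section
/- As s → 0 through nonzero real values, (1/Γ(s) − s − γ s²)/s³ tends to (6γ² − π²)/12; equivalently, the reciprocal Gamma function has the expansion 1/Γ(s) = s + γ s² + ((6γ² − π²)/12) s³ + o(s³) at s = 0, as asserted in the paper's computation of the finite part of the zeta function at s = 0. -/
open Real Filter

/-- The remainder of the second-order Taylor expansion of the reciprocal Gamma function at `1`
has a continuous quotient by `s ^ 2`. -/
lemma exists_inv_Gamma_one_add_eq :
    ∃ h : ℝ → ℝ, ContinuousAt h 0 ∧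
      ∀ s, (Real.Gamma (1 + s))⁻¹ = 1 + Real.eulerMascheroniConstant * s + s ^ 2 * h s := by
  let G : ℂ → ℂ := fun z ↦ (Complex.Gamma (1 + z))⁻¹
  have hG : DifferentiableOn ℂ G Set.univ :=
    (Complex.differentiable_one_div_Gamma.comp
      (differentiable_id.const_add (1 : ℂ))).differentiableOn
  have hD : DifferentiableOn ℂ (dslope G 0) Set.univ :=
    (Complex.differentiableOn_dslope Filter.univ_mem).2 hG
  have hH : DifferentiableOn ℂ (dslope (dslope G 0) 0) Set.univ :=
    (Complex.differentiableOn_dslope Filter.univ_mem).2 hD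
  have hderiv : HasDerivAt G (Real.eulerMascheroniConstant : ℂ) 0 := by
    have h1 : HasDerivAt Complex.Gamma (-(Real.eulerMascheroniConstant : ℂ)) (1 + 0) := by
      simpa using Complex.hasDerivAt_Gamma_one
    simpa [G] using (h1.comp_const_add 1 0).fun_inv (by simp)
  have hD0 : dslope G 0 0 = (Real.eulerMascheroniConstant : ℂ) := by
    rw [dslope_same, hderiv.deriv]
  refine ⟨fun s ↦ (dslope (dslope G 0) 0 (s : ℂ)).re, ?_, fun s ↦ ?_⟩
  · have hcont : Continuous (dslope (dslope G 0) 0) := continuousOn_univ.1 hH.continuousOn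
    exact (Complex.continuous_re.comp (hcont.comp Complex.continuous_ofReal)).continuousAt
  · have e1 := sub_smul_dslope G 0 (s : ℂ)
    have e2 := sub_smul_dslope (dslope G 0) 0 (s : ℂ)
    rw [hD0] at e2
    have hG0 : G 0 = 1 := by simp [G]
    have hGs : G s = (((Real.Gamma (1 + s))⁻¹ : ℝ) : ℂ) := by
      simp [G, ← Complex.Gamma_ofReal]
    rw [hG0, hGs] at e1
    simp only [sub_zero, smul_eq_mul] at e1 e2
    have e3 : (((Real.Gamma (1 + s))⁻¹ : ℝ) : ℂ) =
        ((1 + Real.eulerMascheroniConstant * s : ℝ) : ℂ) +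
          ((s ^ 2 : ℝ) : ℂ) * dslope (dslope G 0) 0 (s : ℂ) := by
      push_cast at e1 ⊢
      linear_combination (s : ℂ) * (-e2) - e1
    have e4 := congrArg Complex.re e3
    rwa [Complex.ofReal_re, Complex.add_re, Complex.ofReal_re, Complex.re_ofReal_mul] at e4

lemma tendsto_sin_sub_self_div_cube :
    Tendsto (fun x : ℝ ↦ (Real.sin x - x) / x ^ 3) (nhdsWithin 0 {0}ᶜ) (nhds (-(1 / 6))) := by
  rw [tendsto_iff_norm_sub_tendsto_zero]
  have hlim : Tendsto (fun x : ℝ ↦ |x| ^ 2 / 100) (nhdsWithin 0 {0}ᶜ) (nhds 0) := by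
    have : Continuous fun x : ℝ ↦ |x| ^ 2 / 100 := by fun_prop
    simpa using (this.tendsto 0).mono_left nhdsWithin_le_nhds
  have hnear : ∀ᶠ x : ℝ in nhdsWithin 0 {0}ᶜ, |x| ≤ 1 := by
    refine nhdsWithin_le_nhds ?_
    filter_upwards [Metric.closedBall_mem_nhds (0 : ℝ) one_pos] with x hx
    simpa using hx
  refine squeeze_zero' (Eventually.of_forall fun _ ↦ norm_nonneg _) ?_ hlim
  filter_upwards [hnear, self_mem_nhdsWithin] with x hx hx0
  have hx0 : x ≠ 0 := hx0
  have hpos : 0 < |x| := abs_pos.2 hx0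
  have e : (Real.sin x - x) / x ^ 3 - -(1 / 6) = (Real.sin x - (x - x ^ 3 / 6)) / x ^ 3 := by
    field_simp
    ring
  rw [e, Real.norm_eq_abs, abs_div, abs_pow, div_le_iff₀ (by positivity)]
  calc |Real.sin x - (x - x ^ 3 / 6)| ≤ |x| ^ 5 / 100 := Real.sin_bound hx
    _ = |x| ^ 2 / 100 * |x| ^ 3 := by ring

/-- Euler's reflection formula, in terms of reciprocals and symmetric about `1`. -/
lemma inv_Gamma_one_add_mul_inv_Gamma_one_sub {s : ℝ} (hs : s ≠ 0) :
    (Real.Gamma (1 + s))⁻¹ * (Real.Gamma (1 - s))⁻¹ = Real.sin (π * s) / (π * s) := by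
  rw [← mul_inv, add_comm, Real.Gamma_add_one hs, mul_assoc, Real.Gamma_mul_Gamma_one_sub,
    mul_inv, inv_div, mul_comm, div_mul_eq_mul_div, div_eq_div_iff Real.pi_ne_zero
      (mul_ne_zero Real.pi_ne_zero hs)]
  field_simp

/-- The reciprocal Gamma function has the expansion
`1/Γ(s) = s + γ s² + ((6γ² − π²)/12) s³ + o(s³)` at `s = 0`: as `s → 0` through nonzero
real values, `(1/Γ(s) − s − γ s²)/s³` tends to `(6γ² − π²)/12`. -/
theorem inv_Gamma_cubic_expansion :
    Tendsto
      (fun s : ℝ =>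
        ((Real.Gamma s)⁻¹ - s - Real.eulerMascheroniConstant * s ^ 2) / s ^ 3)
      (nhdsWithin 0 {0}ᶜ)
      (nhds ((6 * Real.eulerMascheroniConstant ^ 2 - Real.pi ^ 2) / 12)) := by
  obtain ⟨h, hcont, hexp⟩ := exists_inv_Gamma_one_add_eq
  set γ := Real.eulerMascheroniConstant
  have hlim : Tendsto h (nhdsWithin 0 {0}ᶜ) (nhds (h 0)) :=
    hcont.tendsto.mono_left nhdsWithin_le_nhds
  have hscale : Tendsto (fun s : ℝ ↦ π * s) (nhdsWithin 0 {0}ᶜ) (nhdsWithin 0 {0}ᶜ) := by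
    refine tendsto_nhdsWithin_iff.2 ⟨?_, ?_⟩
    · have : Continuous fun s : ℝ ↦ π * s := by fun_prop
      simpa using (this.tendsto 0).mono_left nhdsWithin_le_nhds
    · filter_upwards [self_mem_nhdsWithin] with s hs
      exact mul_ne_zero Real.pi_ne_zero hs
  have hsin := (tendsto_sin_sub_self_div_cube.comp hscale).const_mul (π ^ 2)
  have hprod : Tendsto
      (fun s ↦ h s + h (-s) - γ ^ 2 + γ * s * (h (-s) - h s) + s ^ 2 * (h s * h (-s)))
      (nhdsWithin 0 {0}ᶜ) (nhds (2 * h 0 - γ ^ 2)) := by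
    have hneg : ContinuousAt (fun s ↦ h (-s)) 0 :=
      ContinuousAt.comp (g := h) (by simpa using hcont) continuousAt_neg
    have hc : ContinuousAt
        (fun s ↦ h s + h (-s) - γ ^ 2 + γ * s * (h (-s) - h s) + s ^ 2 * (h s * h (-s))) 0 :=
      (((hcont.add hneg).sub continuousAt_const).add
        ((continuousAt_const.mul continuousAt_id).mul (hneg.sub hcont))).add
        ((continuousAt_id.pow 2).mul (hcont.mul hneg))
    convert hc.tendsto.mono_left nhdsWithin_le_nhds using 2
    simp
    ring
  have hc : 2 * h 0 - γ ^ 2 = π ^ 2 * -(1 / 6) := by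
    refine tendsto_nhds_unique (hprod.congr' ?_) hsin
    filter_upwards [self_mem_nhdsWithin] with s hs
    have hs : s ≠ 0 := hs
    have e := inv_Gamma_one_add_mul_inv_Gamma_one_sub hs
    rw [sub_eq_add_neg, hexp, hexp, eq_div_iff (mul_ne_zero Real.pi_ne_zero hs)] at e
    have hπ := Real.pi_ne_zero
    simp only [Function.comp_apply]
    rw [← e]
    field_simp
    ring
  rw [show (6 * γ ^ 2 - π ^ 2) / 12 = h 0 by linear_combination -hc / 2]
  refine hlim.congr' ?_
  filter_upwards [self_mem_nhdsWithin] with s hs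
  have hs : s ≠ 0 := hs
  have e : (Real.Gamma s)⁻¹ = s * (Real.Gamma (1 + s))⁻¹ := by
    rw [add_comm, Real.Gamma_add_one hs, mul_inv, mul_inv_cancel_left₀ hs]
  rw [e, hexp]
  field_simp
  ring
end

section
/- Let C > 0 and let f : (0,∞) → ℝ be nonnegative and bounded on (0,T] for every T > 0. Assume that f(t) ≤ e^{−Ct/2}(f(t/2) + 1) for all t > 1/C. Then there exists a constant c > 0 such that f(t) ≤ e^{−ct}/c for all t ≥ 1. (This bootstrapping lemma is the mechanism by which the paper upgrades the recursive trace-norm estimate ‖B(t) − A(t)‖_Tr ≤ e^{−Ct/2}(‖B(t/2) − A(t/2)‖_Tr + 1) to uniform exponential decay of the difference between the heat operator and its boundary model in its Proposition on the long-time heat trace.) -/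
open Real Set

/-- A function bounded on `(0, a]` with `f t ≤ (2 / 3) * (f (t / 2) + 1)` for `t > a` is bounded
on `(0, ∞)`. -/
theorem bounded_of_le_halving {a : ℝ} (ha : 0 < a) {f : ℝ → ℝ} {K : ℝ} (hK : 2 ≤ K)
    (hbdd : ∀ t ∈ Ioc 0 a, f t ≤ K)
    (hrec : ∀ t, a < t → f t ≤ 2 / 3 * (f (t / 2) + 1)) {t : ℝ} (ht : 0 < t) : f t ≤ K := by
  have key : ∀ n : ℕ, ∀ s, 0 < s → s ≤ 2 ^ n * a → f s ≤ K := by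
    intro n
    induction n with
    | zero => exact fun s hs hsa => hbdd s ⟨hs, by simpa using hsa⟩
    | succ n ih =>
      intro s hs hsa
      rcases le_or_gt s a with h | h
      · exact hbdd s ⟨hs, h⟩
      · rw [pow_succ] at hsa
        linarith [hrec s h, ih (s / 2) (by linarith) (by linarith)]
  obtain ⟨n, hn⟩ := pow_unbounded_of_one_lt (t / a) (one_lt_two : (1 : ℝ) < 2)
  exact key n t ht ((div_le_iff₀ ha).1 hn.le)

/-- Bootstrapping lemma: if `f ≥ 0` is bounded on every `(0,T]` and satisfies
`f(t) ≤ e^{−Ct/2}(f(t/2) + 1)` for all `t > 1/C`, then there is `c > 0` with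
`f(t) ≤ e^{−ct}/c` for all `t ≥ 1`. -/
theorem exp_decay_bootstrap (C : ℝ) (hC : 0 < C) (f : ℝ → ℝ)
    (hf_nonneg : ∀ t : ℝ, 0 < t → 0 ≤ f t)
    (hf_bdd : ∀ T : ℝ, 0 < T → ∃ M : ℝ, ∀ t ∈ Ioc (0 : ℝ) T, f t ≤ M)
    (hf_rec : ∀ t : ℝ, 1 / C < t → f t ≤ Real.exp (-C * t / 2) * (f (t / 2) + 1)) :
    ∃ c : ℝ, 0 < c ∧ ∀ t : ℝ, 1 ≤ t → f t ≤ Real.exp (-c * t) / c := by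
  have hpos : 0 < 1 / C := by positivity
  obtain ⟨M, hM⟩ := hf_bdd (1 / C) hpos
  set K := max M 2
  have hK : 2 ≤ K := le_max_right _ _
  have hq : Real.exp (-(1 / 2)) ≤ 2 / 3 := by
    rw [Real.exp_neg, inv_le_comm₀ (Real.exp_pos _) (by norm_num)]
    linarith [Real.add_one_le_exp (1 / 2 : ℝ)]
  have hfK : ∀ t, 0 < t → f t ≤ K := fun t ht =>
    bounded_of_le_halving hpos hK (fun s hs => (hM s hs).trans (le_max_left _ _))
      (fun s hs => by
        have hCs : 1 < s * C := (div_lt_iff₀ hC).1 hs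
        have hfs := hf_nonneg (s / 2) (by linarith)
        refine (hf_rec s hs).trans ?_
        gcongr
        exact (Real.exp_le_exp.2 (by linarith)).trans hq) ht
  set A := (K + 1) * Real.exp 1
  have hA : 0 < A := by positivity
  have hdecay : ∀ t, 0 < t → f t ≤ A * Real.exp (-(C / 2) * t) := by
    intro t ht
    rcases le_or_gt t (1 / C) with h | h
    · have hCt : t * C ≤ 1 := (le_div_iff₀ hC).1 h
      have hexp : 1 ≤ Real.exp 1 * Real.exp (-(C / 2) * t) := by
        rw [← Real.exp_add]
        exact Real.one_le_exp (by linarith)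
      calc f t ≤ (K + 1) * 1 := by linarith [hfK t ht]
        _ ≤ (K + 1) * (Real.exp 1 * Real.exp (-(C / 2) * t)) := by gcongr
        _ = A * Real.exp (-(C / 2) * t) := by ring
    · calc f t ≤ Real.exp (-C * t / 2) * (f (t / 2) + 1) := hf_rec t h
        _ ≤ Real.exp (-C * t / 2) * A := by
          gcongr
          calc f (t / 2) + 1 ≤ (K + 1) * 1 := by linarith [hfK (t / 2) (by linarith)]
            _ ≤ (K + 1) * Real.exp 1 := by
              gcongr
              exact Real.one_le_exp zero_le_one
        _ = A * Real.exp (-(C / 2) * t) := by ring_nf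
  have hc : 0 < min (C / 2) A⁻¹ := by positivity
  refine ⟨min (C / 2) A⁻¹, hc, fun t ht => (hdecay t (by linarith)).trans ?_⟩
  rw [div_eq_inv_mul (Real.exp _)]
  gcongr
  · rw [le_inv_comm₀ hA hc]
    exact min_le_right _ _
  · exact min_le_left _ _
end
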